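/- Let (ρ, v) be an equivariant representation of Σ on a Hilbert A-module X. Then there exists a unitary operator W ∈ L(X ⊗_{ℓ_Σ} A^Σ, X^G) satisfying [W(x ⊗̇ ξ)](g) = v(g)^{-1}(x · ξ(g)) for all x ∈ X, ξ ∈ A^Σ and g ∈ G. -/

import Mathlib

open scoped ComplexOrder

noncomputable section

namespace BCFourier

/-- A twisted (unital, discrete) C*-dynamical system `Σ = (A, G, α, σ)`. -/
structure TwistedSystem (A : Type*) (G : Type*) [CStarAlgebra A] [Group G] where
  α : G → (A ≃⋆ₐ[ℂ] A)
  σ : G → G → A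
  σ_unitary : ∀ g h, σ g h ∈ unitary A
  alpha_mul : ∀ g h a, α g (α h a) = σ g h * α (g * h) a * star (σ g h)
  sigma_cocycle : ∀ g h k, σ g h * σ (g * h) k = α g (σ h k) * σ g (h * k)
  sigma_one_left : ∀ g, σ 1 g = 1
  sigma_one_right : ∀ g, σ g 1 = 1

variable {A G B : Type*} [CStarAlgebra A] [Group G] [CStarAlgebra B]

/-- Membership in the Hilbert `A`-module `A^Σ`:  unconditional norm convergence of
`∑_g α_g⁻¹(ξ(g)* ξ(g))`. -/
def MemAS (S : TwistedSystem A G) (ξ : G → A) : Prop :=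
  Summable fun g => (S.α g).symm (star (ξ g) * ξ g)

/-- The `A`-valued inner product `⟨ξ, η⟩_α = ∑_g α_g⁻¹(ξ(g)* η(g))` on `A^Σ`. -/
def innerAS (S : TwistedSystem A G) (ξ η : G → A) : A :=
  ∑' g, (S.α g).symm (star (ξ g) * η g)

/-- The norm `‖ξ‖_α = ‖⟨ξ,ξ⟩_α‖^{1/2}` on `A^Σ`. -/
def normAS (S : TwistedSystem A G) (ξ : G → A) : ℝ :=
  Real.sqrt ‖innerAS S ξ ξ‖

/-- Abstract characterization of the reduced twisted crossed product `C*_r(Σ)`: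
a C*-algebra `B` together with a copy `ι` of `A`, unitaries `u g` implementing the
twisted action, and the canonical faithful conditional expectation `E`, such that
the Fourier coefficients `x̂(g) = E(x u_g*)` lie in `A^Σ`, `E(x* x) = ⟨x̂, x̂⟩_α`,
and `B` is topologically generated by the elements `ι(a) u g`. -/
structure CrossedProduct {A G : Type*} [CStarAlgebra A] [Group G]
    (S : TwistedSystem A G) (B : Type*) [CStarAlgebra B] where
  ι : A →⋆ₐ[ℂ] B
  ι_isometric : ∀ a, ‖ι a‖ = ‖a‖
  u : G → B
  u_unitary : ∀ g, u g ∈ unitary B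
  u_one : u 1 = 1
  covariance : ∀ g a, u g * ι a = ι (S.α g a) * u g
  u_mul : ∀ g h, u g * u h = ι (S.σ g h) * u (g * h)
  E : B →L[ℂ] A
  E_iota : ∀ a, E (ι a) = a
  E_perp : ∀ a g, g ≠ 1 → E (ι a * u g) = 0
  E_contractive : ∀ x, ‖E x‖ ≤ ‖x‖
  E_faithful : ∀ x, E (star x * x) = 0 → x = 0
  hat_mem : ∀ x : B, MemAS S fun g => E (x * star (u g))
  E_inner : ∀ x : B,
    E (star x * x) = innerAS S (fun g => E (x * star (u g))) fun g => E (x * star (u g))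
  generated : Dense (↑(Submodule.span ℂ {b : B | ∃ a g, b = ι a * u g}) : Set B)

variable {S : TwistedSystem A G}

/-- The Fourier transform `x̂ : G → A` of `x ∈ C*_r(Σ)`. -/
def hatF (D : CrossedProduct S B) (x : B) : G → A := fun g => D.E (x * star (D.u g))

/-- The norm `‖x‖_α = ‖x̂‖_α = ‖E(x* x)‖^{1/2}` on `C*_r(Σ)`. -/
def alphaNorm (D : CrossedProduct S B) (x : B) : ℝ := Real.sqrt ‖D.E (star x * x)‖

/-- `Λ_Σ(f) = ∑_g f(g) λ_Σ(g)` for finitely supported `f : G → A`. -/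
def Lam (D : CrossedProduct S B) (f : G → A) : B := ∑ᶠ g, D.ι (f g) * D.u g

/-- `CF(Σ)`: the set of `x ∈ C*_r(Σ)` whose Fourier series `∑_g x̂(g) λ_Σ(g)`
converges unconditionally in the operator norm. -/
def CFmem (D : CrossedProduct S B) (x : B) : Prop :=
  ∃ y : B, HasSum (fun g => D.ι (hatF D x g) * D.u g) y

/-- `M : C*_r(Σ) → C*_r(Σ)` is the bounded map associated with the (reduced)
multiplier `T : G × A → A`, i.e. `T ∈ MA(Σ)` with `M_T = M`. -/
def IsMultiplier (D : CrossedProduct S B) (T : G → A → A) (M : B →L[ℂ] B) : Prop :=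
  (∀ g, IsLinearMap ℂ (T g)) ∧ ∀ g a, M (D.ι a * D.u g) = D.ι (T g a) * D.u g

/-- The norm of a column vector in the Hilbert `B`-module `Bⁿ`. -/
def vecNorm {n : ℕ} (x : Fin n → B) : ℝ := Real.sqrt ‖∑ i, star (x i) * x i‖

/-- The C*-norm on `Mₙ(B)`, realized as the operator norm for the action of
matrices on the Hilbert `B`-module `Bⁿ`. -/
def matNorm {n : ℕ} (m : Matrix (Fin n) (Fin n) B) : ℝ :=
  sInf {M : ℝ | 0 ≤ M ∧ ∀ x : Fin n → B, vecNorm (m.mulVec x) ≤ M * vecNorm x}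

/-- `φ : B → B` is completely bounded with cb-norm at most `M`. -/
def CBBoundedBy (φ : B → B) (M : ℝ) : Prop :=
  0 ≤ M ∧ ∀ (n : ℕ) (m : Matrix (Fin n) (Fin n) B), matNorm (m.map φ) ≤ M * matNorm m

/-- The completely bounded norm `‖φ‖_cb`. -/
def cbNorm (φ : B → B) : ℝ := sInf {M : ℝ | CBBoundedBy φ M}

/-- `φ : B → B` is completely bounded. -/
def IsCompletelyBounded (φ : B → B) : Prop := ∃ M, CBBoundedBy φ M

/-- `φ : B → B` is completely positive. -/
def IsCompletelyPositive [PartialOrder B] [StarOrderedRing B] (φ : B → B) : Prop :=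
  ∀ (n : ℕ) (b c : Fin n → B), 0 ≤ ∑ i, ∑ j, star (c i) * φ (star (b i) * b j) * c j

/-- `ξ` tends to `0` at infinity w.r.t. the norm `N`. -/
def TendsZeroAtInfty (N : (G → A) → ℝ) (ξ : G → A) : Prop :=
  ∀ ε : ℝ, 0 < ε → ∃ F₀ : Finset G, ∀ F : Finset G, Disjoint F F₀ →
    N (Set.indicator (↑F : Set G) ξ) < ε

/-- The (closed, two-sided) ideal of `C*_r(Σ)` induced by a subset `J` of `A`. -/
def genIdeal (D : CrossedProduct S B) (J : Set A) : Set B :=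
  closure ↑(Submodule.span ℂ {z : B | ∃ x y : B, ∃ j ∈ J, z = x * D.ι j * y})

/-- `J` is an `α`-invariant closed two-sided ideal of `A`. -/
def IsInvIdeal (S : TwistedSystem A G) (J : Set A) : Prop :=
  IsClosed J ∧ (0 : A) ∈ J ∧ (∀ a b, a ∈ J → b ∈ J → a + b ∈ J) ∧
    (∀ a ∈ J, ∀ b : A, b * a ∈ J ∧ a * b ∈ J) ∧ ∀ g, ∀ a ∈ J, S.α g a ∈ J

/-- A closed two-sided ideal of a C*-algebra, as a set. -/
def IsClosedIdeal {B : Type*} [CStarAlgebra B] (I : Set B) : Prop :=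
  IsClosed I ∧ (0 : B) ∈ I ∧ (∀ x y, x ∈ I → y ∈ I → x + y ∈ I) ∧
    ∀ x ∈ I, ∀ b : B, b * x ∈ I ∧ x * b ∈ I

/-- An ideal `I` of `C*_r(Σ)` is `E`-invariant when `E(I) ⊆ I`. -/
def EInv (D : CrossedProduct S B) (I : Set B) : Prop := ∀ x ∈ I, D.ι (D.E x) ∈ I

/-- A Fourier summing net for `Σ`: a net `{Tⁱ}` in `MCF(Σ)` such that
`M_{Tⁱ}(x) → x` in norm for every `x ∈ C*_r(Σ)`. -/
structure FSNet {A G : Type*} [CStarAlgebra A] [Group G] {S : TwistedSystem A G}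
    {B : Type*} [CStarAlgebra B] (D : CrossedProduct S B) where
  Idx : Type
  pre : Preorder Idx
  dir : IsDirected Idx fun a b => pre.le a b
  nonempty : Nonempty Idx
  T : Idx → G → A → A
  T_lin : ∀ i g, IsLinearMap ℂ (T i g)
  M : Idx → B →L[ℂ] B
  M_mult : ∀ i g a, M i (D.ι a * D.u g) = D.ι (T i g a) * D.u g
  M_cf : ∀ i x, CFmem D (M i x)
  M_lim : ∀ x : B, Filter.Tendsto (fun i => ‖M i x - x‖) (@Filter.atTop Idx pre) (nhds 0)

/-- `Σ` has the bounded Fejér property: there is a bounded Fourier summing net for `Σ`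
consisting of multipliers with finite `G`-support. -/
def HasBoundedFejer (D : CrossedProduct S B) : Prop :=
  ∃ net : FSNet D, (∃ C : ℝ, ∀ i, ‖net.M i‖ ≤ C) ∧ ∀ i, {g | ∃ a, net.T i g a ≠ 0}.Finite


/-- A (right) Hilbert `A`-module structure on `X`: right `A`-action `smulA`,
`A`-valued inner product (linear in the second variable), with
`‖x‖ = ‖⟨x,x⟩‖^{1/2}`. -/
structure HilbMod (A : Type*) [CStarAlgebra A] [PartialOrder A] [StarOrderedRing A]
    (X : Type*) [NormedAddCommGroup X] [NormedSpace ℂ X] where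
  smulA : X → A → X
  inner : X → X → A
  smulA_add : ∀ x a b, smulA x (a + b) = smulA x a + smulA x b
  add_smulA : ∀ x y a, smulA (x + y) a = smulA x a + smulA y a
  smulA_mul : ∀ x a b, smulA x (a * b) = smulA (smulA x a) b
  smulA_one : ∀ x, smulA x 1 = x
  smulA_smul : ∀ (c : ℂ) x a, smulA (c • x) a = c • smulA x a
  smul_smulA : ∀ (c : ℂ) x a, smulA x (c • a) = c • smulA x a
  inner_add_right : ∀ x y z, inner x (y + z) = inner x y + inner x z
  inner_smulA_right : ∀ x y a, inner x (smulA y a) = inner x y * a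
  inner_smul_right : ∀ (c : ℂ) x y, inner x (c • y) = c • inner x y
  inner_conj : ∀ x y, star (inner x y) = inner y x
  inner_self_nonneg : ∀ x, 0 ≤ inner x x
  inner_self_eq_zero : ∀ x, inner x x = 0 → x = 0
  norm_eq : ∀ x, ‖x‖ = Real.sqrt ‖inner x x‖

/-- `π` is a representation of `A` by adjointable operators on the Hilbert
`A`-module `X`. -/
def IsRepOn {A X : Type*} [CStarAlgebra A] [PartialOrder A] [StarOrderedRing A]
    [NormedAddCommGroup X] [NormedSpace ℂ X] (hX : HilbMod A X) (π : A → X →L[ℂ] X) : Prop :=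
  π 1 = ContinuousLinearMap.id ℂ X ∧
  (∀ a b x, π (a * b) x = π a (π b x)) ∧
  (∀ a b, π (a + b) = π a + π b) ∧
  (∀ (c : ℂ) a, π (c • a) = c • π a) ∧
  (∀ a x y, hX.inner (π a x) y = hX.inner x (π (star a) y)) ∧
  ∀ a x b, π a (hX.smulA x b) = hX.smulA (π a x) b

/-- An equivariant representation `(ρ, v)` of `Σ` on a Hilbert `A`-module `X`. -/
structure EquivRep {A G : Type*} [CStarAlgebra A] [PartialOrder A] [StarOrderedRing A]
    [Group G] (S : TwistedSystem A G) {X : Type*} [NormedAddCommGroup X] [NormedSpace ℂ X]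
    (hX : HilbMod A X) where
  ρ : A → X →L[ℂ] X
  ρ_rep : IsRepOn hX ρ
  v : G → X ≃L[ℂ] X
  cov : ∀ g a x, ρ (S.α g a) x = v g (ρ a ((v g).symm x))
  v_mul : ∀ g h x, v g (v h x) = hX.smulA (ρ (S.σ g h) (v (g * h) x)) (star (S.σ g h))
  v_inner : ∀ g x y, S.α g (hX.inner x y) = hX.inner (v g x) (v g y)
  v_smulA : ∀ g x a, v g (hX.smulA x a) = hX.smulA (v g x) (S.α g a)

/-- The data of the quotient system `Σ̃ = (A/J, G, α̃, σ̃)`, its reduced crossed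
product, and the canonical map `q̃ : C*_r(Σ) → C*_r(Σ̃)`. -/
structure QuotientData {A G : Type*} [CStarAlgebra A] [Group G] {S : TwistedSystem A G}
    {B : Type*} [CStarAlgebra B] (D : CrossedProduct S B) (J : Set A) where
  Aq : Type
  [algAq : CStarAlgebra Aq]
  Sq : @TwistedSystem Aq G algAq _
  Bq : Type
  [algBq : CStarAlgebra Bq]
  Dq : @CrossedProduct Aq G algAq _ Sq Bq algBq
  q : A → Aq
  q_add : ∀ a b, q (a + b) = q a + q b
  q_mul : ∀ a b, q (a * b) = q a * q b
  q_star : ∀ a, q (star a) = star (q a)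
  q_smul : ∀ (c : ℂ) a, q (c • a) = c • q a
  q_one : q 1 = 1
  q_surj : Function.Surjective q
  q_ker : ∀ a, q a = 0 ↔ a ∈ J
  q_alpha : ∀ g a, q (S.α g a) = Sq.α g (q a)
  q_sigma : ∀ g h, q (S.σ g h) = Sq.σ g h
  Q : B → Bq
  Q_add : ∀ x y, Q (x + y) = Q x + Q y
  Q_smul : ∀ (c : ℂ) x, Q (c • x) = c • Q x
  Q_mul : ∀ x y, Q (x * y) = Q x * Q y
  Q_star : ∀ x, Q (star x) = star (Q x)
  Q_cont : Continuous Q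
  Q_gen : ∀ a g, Q (D.ι a * D.u g) = Dq.ι (q a) * Dq.u g

attribute [instance] QuotientData.algAq QuotientData.algBq

/-- The data of the reduced group C*-algebra `C*_r(G)`, the minimal tensor
product `C*_r(Σ) ⊗ C*_r(G)` and the reduced dual coaction
`δ_Σ : C*_r(Σ) → C*_r(Σ) ⊗ C*_r(G)`, `δ_Σ(a λ_Σ(g)) = a λ_Σ(g) ⊗ λ(g)`,
together with the slice map `id ⊗ τ` satisfying `(id ⊗ τ) ∘ δ_Σ = E`. -/
structure CoactionData {A G : Type*} [CStarAlgebra A] [Group G] {S : TwistedSystem A G}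
    {B : Type*} [CStarAlgebra B] (D : CrossedProduct S B) where
  CG : Type
  [algCG : CStarAlgebra CG]
  lam : G → CG
  lam_unitary : ∀ g, lam g ∈ unitary CG
  lam_mul : ∀ g h, lam (g * h) = lam g * lam h
  lam_gen : Dense (↑(Submodule.span ℂ (Set.range lam)) : Set CG)
  tau : CG →L[ℂ] ℂ
  tau_pos : ∀ c, 0 ≤ tau (star c * c)
  tau_lam_one : tau (lam 1) = 1
  tau_lam_ne : ∀ g, g ≠ 1 → tau (lam g) = 0
  BT : Type
  [algBT : CStarAlgebra BT]
  tens : B → CG → BT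
  tens_add_left : ∀ x y c, tens (x + y) c = tens x c + tens y c
  tens_add_right : ∀ x c d, tens x (c + d) = tens x c + tens x d
  tens_smul_left : ∀ (z : ℂ) x c, tens (z • x) c = z • tens x c
  tens_smul_right : ∀ (z : ℂ) x c, tens x (z • c) = z • tens x c
  tens_mul : ∀ x y c d, tens x c * tens y d = tens (x * y) (c * d)
  tens_star : ∀ x c, star (tens x c) = tens (star x) (star c)
  tens_norm : ∀ x c, ‖tens x c‖ = ‖x‖ * ‖c‖
  tens_gen : Dense (↑(Submodule.span ℂ {z : BT | ∃ x c, z = tens x c}) : Set BT)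
  slice : BT →L[ℂ] B
  slice_tens : ∀ x c, slice (tens x c) = tau c • x
  delta : B → BT
  delta_add : ∀ x y, delta (x + y) = delta x + delta y
  delta_smul : ∀ (z : ℂ) x, delta (z • x) = z • delta x
  delta_mul : ∀ x y, delta (x * y) = delta x * delta y
  delta_star : ∀ x, delta (star x) = star (delta x)
  delta_cont : Continuous delta
  delta_gen : ∀ a g, delta (D.ι a * D.u g) = tens (D.ι a * D.u g) (lam g)
  slice_delta : ∀ x, slice (delta x) = D.ι (D.E x)

attribute [instance] CoactionData.algCG CoactionData.algBT


namespace HilbMod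

section Inner

variable {A : Type*} [CStarAlgebra A] [PartialOrder A] [StarOrderedRing A]
  {X : Type*} [NormedAddCommGroup X] [NormedSpace ℂ X] (H : HilbMod A X)

/-- The `A`-valued inner product as a linear map in its second variable. -/
def innerRight (x : X) : X →ₗ[ℂ] A where
  toFun := H.inner x
  map_add' := H.inner_add_right x
  map_smul' c y := H.inner_smul_right c x y

lemma inner_sub_right (x y z : X) : H.inner x (y - z) = H.inner x y - H.inner x z :=
  map_sub (H.innerRight x) y z

lemma inner_sum_right {ι : Type*} (x : X) (s : Finset ι) (y : ι → X) :
    H.inner x (∑ i ∈ s, y i) = ∑ i ∈ s, H.inner x (y i) :=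
  map_sum (H.innerRight x) y s

lemma inner_real_smul_right (r : ℝ) (x y : X) : H.inner x (r • y) = r • H.inner x y := by
  rw [← Complex.coe_smul, ← Complex.coe_smul, H.inner_smul_right]

lemma inner_sub_left (x y z : X) : H.inner (x - y) z = H.inner x z - H.inner y z := by
  rw [← H.inner_conj, inner_sub_right, star_sub, H.inner_conj, H.inner_conj]

lemma inner_sum_left {ι : Type*} (s : Finset ι) (x : ι → X) (y : X) :
    H.inner (∑ i ∈ s, x i) y = ∑ i ∈ s, H.inner (x i) y := by
  rw [← H.inner_conj, inner_sum_right, star_sum]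
  simp only [H.inner_conj]

lemma inner_real_smul_left (r : ℝ) (x y : X) : H.inner (r • x) y = r • H.inner x y := by
  rw [← H.inner_conj, inner_real_smul_right, star_smul, H.inner_conj, star_trivial]

lemma inner_smulA_left (x y : X) (a : A) : H.inner (H.smulA x a) y = star a * H.inner x y := by
  rw [← H.inner_conj, H.inner_smulA_right, star_mul, H.inner_conj]

lemma norm_sq_eq (x : X) : ‖x‖ ^ 2 = ‖H.inner x x‖ := by
  rw [H.norm_eq, Real.sq_sqrt (norm_nonneg _)]

lemma ext_inner_left {y z : X} (h : ∀ x, H.inner x y = H.inner x z) : y = z := by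
  refine sub_eq_zero.1 (H.inner_self_eq_zero _ ?_)
  rw [inner_sub_right, h, sub_self]

lemma star_inner_mul_inner_le (x y : X) :
    star (H.inner x y) * H.inner x y ≤ ‖x‖ ^ 2 • H.inner y y := by
  rcases eq_or_ne x 0 with rfl | hx
  · have h : H.inner 0 y = 0 := by simpa using H.inner_sub_left 0 0 y
    simp [h]
  set c := H.inner x y with hc
  have hr : 0 < ‖x‖ ^ 2 := by positivity
  have hnn := H.inner_self_nonneg (H.smulA x c - (‖x‖ ^ 2) • y)
  have hle : star c * H.inner x x * c ≤ ‖x‖ ^ 2 • (star c * c) := by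
    rw [H.norm_sq_eq]
    exact CStarAlgebra.star_left_conjugate_le_norm_smul (hb := H.inner_conj x x)
  have hyx : H.inner y x = star c := by rw [hc, H.inner_conj]
  simp only [inner_sub_left, inner_sub_right, inner_smulA_left, H.inner_smulA_right,
    inner_real_smul_left, inner_real_smul_right, hyx, ← hc, sub_mul, smul_mul_assoc, smul_sub] at hnn
  have h : (0 : A) ≤ ‖x‖ ^ 2 • (‖x‖ ^ 2 • H.inner y y) - ‖x‖ ^ 2 • (star c * c) :=
    calc (0 : A) ≤ _ := hnn
      _ = star c * H.inner x x * c - ‖x‖ ^ 2 • (star c * c)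
            + (‖x‖ ^ 2 • (‖x‖ ^ 2 • H.inner y y) - ‖x‖ ^ 2 • (star c * c)) := by abel
      _ ≤ _ := add_le_of_nonpos_left (sub_nonpos.2 hle)
  exact (smul_le_smul_iff_of_pos_left hr).1 (sub_nonneg.1 h)

/-- The Cauchy-Schwarz inequality. -/
lemma norm_inner_le (x y : X) : ‖H.inner x y‖ ≤ ‖x‖ * ‖y‖ := by
  refine (pow_le_pow_iff_left₀ (norm_nonneg _) (by positivity) two_ne_zero).1 ?_
  calc ‖H.inner x y‖ ^ 2 = ‖star (H.inner x y) * H.inner x y‖ := by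
        rw [CStarRing.norm_star_mul_self, pow_two]
    _ ≤ ‖‖x‖ ^ 2 • H.inner y y‖ :=
        CStarAlgebra.norm_le_norm_of_nonneg_of_le (star_mul_self_nonneg _)
          (H.star_inner_mul_inner_le x y)
    _ = (‖x‖ * ‖y‖) ^ 2 := by
        rw [norm_smul, ← H.norm_sq_eq, mul_pow, Real.norm_of_nonneg (by positivity)]

lemma continuous_inner_right (x : X) : Continuous (H.inner x) :=
  AddMonoidHomClass.continuous_of_bound (H.innerRight x) ‖x‖ (H.norm_inner_le x)

lemma hasSum_inner_right {ι : Type*} (x : X) {y : ι → X} {z : X} (h : HasSum y z) :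
    HasSum (fun i => H.inner x (y i)) (H.inner x z) :=
  h.map (H.innerRight x) (H.continuous_inner_right x)

lemma norm_le_of_inner_self_eq {x y : X} (h : H.inner x x = H.inner x y) : ‖x‖ ≤ ‖y‖ := by
  rcases (norm_nonneg x).eq_or_lt with h0 | h0
  · rw [← h0]; exact norm_nonneg y
  · refine le_of_mul_le_mul_left ?_ h0
    rw [← pow_two, H.norm_sq_eq, h]
    exact H.norm_inner_le x y

end Inner

section Decomposition

variable {A : Type*} [CStarAlgebra A] [PartialOrder A] [StarOrderedRing A]
  {X : Type*} [NormedAddCommGroup X] [NormedSpace ℂ X]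
  {T : Type*} [NormedAddCommGroup T] [NormedSpace ℂ T]
  {hX : HilbMod A X} {hT : HilbMod A T} {ι : Type*}

/-- An inner-product preserving linear map which has an adjoint on a set with dense span has an
everywhere defined adjoint. -/
lemma exists_adjoint_of_dense [CompleteSpace X] {f : X →ₗ[ℂ] T}
    (hf : ∀ x y, hT.inner (f x) (f y) = hX.inner x y) {D : Set T}
    (hD : Dense (Submodule.span ℂ D : Set T))
    (hadj : ∀ t ∈ D, ∃ y, ∀ x, hT.inner (f x) t = hX.inner x y) :
    ∃ P : T →ₗ[ℂ] X, ∀ x t, hT.inner (f x) t = hX.inner x (P t) := by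
  let M : Submodule ℂ T :=
    { carrier := {t | ∃ y, ∀ x, hT.inner (f x) t = hX.inner x y}
      add_mem' := by
        rintro s t ⟨y, hy⟩ ⟨z, hz⟩
        exact ⟨y + z, fun x => by rw [hT.inner_add_right, hX.inner_add_right, hy, hz]⟩
      zero_mem' := ⟨0, fun x => by
        rw [show hT.inner (f x) 0 = 0 from map_zero (hT.innerRight (f x)),
          show hX.inner x 0 = 0 from map_zero (hX.innerRight x)]⟩
      smul_mem' := by
        rintro c t ⟨y, hy⟩
        exact ⟨c • y, fun x => by rw [hT.inner_smul_right, hX.inner_smul_right, hy]⟩ }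
  have hbound : ∀ {t y}, (∀ x, hT.inner (f x) t = hX.inner x y) → ‖y‖ ≤ ‖t‖ := by
    intro t y h
    have h1 : ‖f y‖ = ‖y‖ := by rw [hT.norm_eq, hX.norm_eq, hf]
    rw [← h1]
    exact hT.norm_le_of_inner_self_eq (by rw [hf, h])
  have hM : ∀ t, t ∈ M := by
    intro t
    obtain ⟨u, hu, hut⟩ := mem_closure_iff_seq_limit.1
      (hD.mono (Submodule.span_le.2 hadj : Submodule.span ℂ D ≤ M) t)
    choose y hy using hu
    have hcauchy : CauchySeq y := by
      refine Metric.cauchySeq_iff.2 fun ε hε => ?_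
      obtain ⟨N, hN⟩ := Metric.cauchySeq_iff.1 hut.cauchySeq ε hε
      refine ⟨N, fun m hm n hn => lt_of_le_of_lt ?_ (hN m hm n hn)⟩
      rw [dist_eq_norm, dist_eq_norm]
      exact hbound fun x => by rw [inner_sub_right, inner_sub_right, hy, hy]
    obtain ⟨z, hz⟩ := cauchySeq_tendsto_of_complete hcauchy
    refine ⟨z, fun x => tendsto_nhds_unique
      (((hT.continuous_inner_right (f x)).tendsto t).comp hut) ?_⟩
    refine (((hX.continuous_inner_right x).tendsto z).comp hz).congr fun n => (hy n x).symm
  choose P hP using hM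
  refine ⟨⟨⟨P, fun s t => hX.ext_inner_left fun x => ?_⟩,
    fun c t => hX.ext_inner_left fun x => ?_⟩, fun x t => hP t x⟩
  · rw [← hP, hT.inner_add_right, hX.inner_add_right, hP, hP]
  · rw [← hP, hT.inner_smul_right, hP, RingHom.id_apply, hX.inner_smul_right]

variable {f : ι → X →ₗ[ℂ] T} {P : ι → T →ₗ[ℂ] X}

lemma inner_sum_self_of_orthogonal (hf : ∀ i x y, hT.inner (f i x) (f i y) = hX.inner x y)
    (hne : ∀ i j, i ≠ j → ∀ x y, hT.inner (f i x) (f j y) = 0) (F : Finset ι) (ζ : ι → X) :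
    hT.inner (∑ i ∈ F, f i (ζ i)) (∑ i ∈ F, f i (ζ i)) = ∑ i ∈ F, hX.inner (ζ i) (ζ i) := by
  rw [inner_sum_left]
  refine Finset.sum_congr rfl fun i hi => ?_
  rw [inner_sum_right, Finset.sum_eq_single i (fun j _ hj => hne i j hj.symm _ _)
    (fun h => absurd hi h), hf]

lemma inner_sub_sum_self (hf : ∀ i x y, hT.inner (f i x) (f i y) = hX.inner x y)
    (hne : ∀ i j, i ≠ j → ∀ x y, hT.inner (f i x) (f j y) = 0)
    (hP : ∀ i x t, hT.inner (f i x) t = hX.inner x (P i t)) (F : Finset ι) (t : T) :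
    hT.inner (t - ∑ i ∈ F, f i (P i t)) (t - ∑ i ∈ F, f i (P i t))
        = hT.inner t t - ∑ i ∈ F, hX.inner (P i t) (P i t) ∧
      hT.inner (t - ∑ i ∈ F, f i (P i t)) t
        = hT.inner t t - ∑ i ∈ F, hX.inner (P i t) (P i t) := by
  have h1 : hT.inner (∑ i ∈ F, f i (P i t)) t = ∑ i ∈ F, hX.inner (P i t) (P i t) := by
    simp only [inner_sum_left, hP]
  have h2 : hT.inner t (∑ i ∈ F, f i (P i t)) = ∑ i ∈ F, hX.inner (P i t) (P i t) := by
    rw [← hT.inner_conj, h1, star_sum]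
    simp only [hX.inner_conj]
  refine ⟨?_, by rw [inner_sub_left, h1]⟩
  rw [inner_sub_left, inner_sub_right, inner_sub_right, h1, h2,
    inner_sum_self_of_orthogonal hf hne, sub_self, sub_zero]

/-- If Parseval's identity holds on a set with dense span, then every vector is the sum of its
orthogonal components. -/
lemma hasSum_of_dense (hf : ∀ i x y, hT.inner (f i x) (f i y) = hX.inner x y)
    (hne : ∀ i j, i ≠ j → ∀ x y, hT.inner (f i x) (f j y) = 0)
    (hP : ∀ i x t, hT.inner (f i x) t = hX.inner x (P i t)) {D : Set T}
    (hD : Dense (Submodule.span ℂ D : Set T))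
    (hsum : ∀ t ∈ D, HasSum (fun i => hX.inner (P i t) (P i t)) (hT.inner t t)) (t : T) :
    HasSum (fun i => f i (P i t)) t := by
  let M : Submodule ℂ T :=
    { carrier := {t | HasSum (fun i => f i (P i t)) t}
      add_mem' := fun {s t} hs ht => by
        simpa only [Set.mem_ofPred_eq, map_add] using HasSum.add hs ht
      zero_mem' := by simpa only [Set.mem_ofPred_eq, map_zero] using hasSum_zero
      smul_mem' := fun c t ht => by
        simpa only [Set.mem_ofPred_eq, map_smul] using HasSum.const_smul c ht }
  have hDM : D ⊆ M := by
    intro t ht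
    change Filter.Tendsto _ _ _
    rw [tendsto_iff_norm_sub_tendsto_zero]
    have h := ((hsum t ht).const_sub (hT.inner t t)).norm.sqrt
    rw [sub_self, norm_zero, Real.sqrt_zero] at h
    refine h.congr fun F => ?_
    rw [norm_sub_rev _ t, hT.norm_eq, (inner_sub_sum_self hf hne hP F t).1]
  have hle : ∀ (F : Finset ι) (u : T), ‖u - ∑ i ∈ F, f i (P i u)‖ ≤ ‖u‖ := fun F u =>
    hT.norm_le_of_inner_self_eq <|
      (inner_sub_sum_self hf hne hP F u).1.trans (inner_sub_sum_self hf hne hP F u).2.symm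
  refine Metric.tendsto_nhds.2 fun ε hε => ?_
  obtain ⟨s, hs, hst⟩ := Metric.mem_closure_iff.1
    (hD.mono (Submodule.span_le.2 hDM : Submodule.span ℂ D ≤ M) t) (ε / 2) (half_pos hε)
  filter_upwards [Metric.tendsto_nhds.1 (show HasSum _ _ from hs) (ε / 2) (half_pos hε)] with F hF
  rw [dist_comm, dist_eq_norm] at hF ⊢
  rw [dist_eq_norm] at hst
  have hsplit : t - ∑ i ∈ F, f i (P i t)
      = (t - s - ∑ i ∈ F, f i (P i (t - s))) + (s - ∑ i ∈ F, f i (P i s)) := by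
    simp only [map_sub, Finset.sum_sub_distrib]
    abel
  rw [hsplit]
  linarith [norm_add_le (t - s - ∑ i ∈ F, f i (P i (t - s))) (s - ∑ i ∈ F, f i (P i s)),
    hle F (t - s)]

/-- Square-summable families are the families of components of a vector. -/
lemma exists_components_eq [CompleteSpace T]
    (hf : ∀ i x y, hT.inner (f i x) (f i y) = hX.inner x y)
    (hne : ∀ i j, i ≠ j → ∀ x y, hT.inner (f i x) (f j y) = 0)
    (hP : ∀ i x t, hT.inner (f i x) t = hX.inner x (P i t)) {ζ : ι → X}
    (hζ : Summable fun i => hX.inner (ζ i) (ζ i)) : ∃ t, ∀ i, P i t = ζ i := by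
  have hs : Summable fun i => f i (ζ i) := by
    refine summable_iff_vanishing_norm.2 fun ε hε => ?_
    obtain ⟨s, h⟩ := summable_iff_vanishing_norm.1 hζ (ε ^ 2) (by positivity)
    refine ⟨s, fun F hF => ?_⟩
    refine lt_of_pow_lt_pow_left₀ 2 hε.le ?_
    rw [hT.norm_sq_eq, inner_sum_self_of_orthogonal hf hne]
    exact h F hF
  refine ⟨∑' i, f i (ζ i), fun i => hX.ext_inner_left fun x => ?_⟩
  have h := hT.hasSum_inner_right (f i x) hs.hasSum
  have h' : HasSum (fun j => hT.inner (f i x) (f j (ζ j))) (hT.inner (f i x) (f i (ζ i))) :=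
    hasSum_single i fun j hj => hne i j hj.symm _ _
  rw [← hP, ← hf i]
  exact h.unique h'

end Decomposition

end HilbMod

section TwistedModule

variable {A G : Type*} [CStarAlgebra A] [Group G]

open Classical in
lemma memAS_single (S : TwistedSystem A G) (g : G) (a : A) : MemAS S (Pi.single g a) :=
  summable_of_ne_finset_zero (s := {g}) fun h hh => by
    simp [Pi.single_eq_of_ne (Finset.notMem_singleton.1 hh)]

variable [PartialOrder A] [StarOrderedRing A]

lemma summable_of_nonneg_of_le {ι : Type*} {a b : ι → A} (ha : ∀ i, 0 ≤ a i)
    (hab : ∀ i, a i ≤ b i) (hb : Summable b) : Summable a := by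
  refine summable_iff_vanishing_norm.2 fun ε hε => ?_
  obtain ⟨s, h⟩ := summable_iff_vanishing_norm.1 hb ε hε
  exact ⟨s, fun F hF => lt_of_le_of_lt (CStarAlgebra.norm_le_norm_of_nonneg_of_le
    (Finset.sum_nonneg fun i _ => ha i) (Finset.sum_le_sum fun i _ => hab i)) (h F hF)⟩

lemma MemAS.summable_conjugate {S : TwistedSystem A G} {ξ : G → A} (hξ : MemAS S ξ) {b : A}
    (hb : 0 ≤ b) : Summable fun g => (S.α g).symm (star (ξ g) * (b * ξ g)) := by
  refine summable_of_nonneg_of_le (fun g => ?_) (fun g => ?_)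
    (Summable.const_smul (‖b‖ : ℂ) hξ)
  · refine map_nonneg _ ?_
    rw [← mul_assoc]
    exact star_left_conjugate_nonneg hb _
  · rw [← map_smul]
    refine OrderHomClass.mono _ ?_
    rw [← mul_assoc, Complex.coe_smul]
    exact CStarAlgebra.star_left_conjugate_le_norm_smul

lemma EquivRep.inner_symm_right {S : TwistedSystem A G} {X : Type*} [NormedAddCommGroup X]
    [NormedSpace ℂ X] {hX : HilbMod A X} (er : EquivRep S hX) (g : G) (x y : X) :
    hX.inner x ((er.v g).symm y) = (S.α g).symm (hX.inner (er.v g x) y) := by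
  rw [StarAlgEquiv.eq_symm_apply, er.v_inner, ContinuousLinearEquiv.apply_symm_apply]

end TwistedModule

/-- Lemma `W`. For an equivariant representation `(ρ, v)` of
`Σ` on a Hilbert `A`-module `X`, there is a unitary
`W ∈ L(X ⊗_{ℓ_Σ} A^Σ, X^G)` with `[W (x ⊗̇ ξ)](g) = v(g)⁻¹ (x · ξ(g))`. -/
theorem statement9 {A G : Type*} [CStarAlgebra A] [PartialOrder A] [StarOrderedRing A]
    [Group G] (S : TwistedSystem A G)
    {X : Type*} [NormedAddCommGroup X] [NormedSpace ℂ X] [CompleteSpace X]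
    (hX : HilbMod A X) (er : EquivRep S hX)
    -- `T` is the internal tensor product Hilbert `A`-module `X ⊗_{ℓ_Σ} A^Σ`
    {T : Type*} [NormedAddCommGroup T] [NormedSpace ℂ T] [CompleteSpace T]
    (hT : HilbMod A T) (tmul : X → (G → A) → T)
    (t_add_l : ∀ x x' ξ, MemAS S ξ → tmul (x + x') ξ = tmul x ξ + tmul x' ξ)
    (t_add_r : ∀ x ξ η, MemAS S ξ → MemAS S η → tmul x (ξ + η) = tmul x ξ + tmul x η)
    (t_smul : ∀ (c : ℂ) x ξ, MemAS S ξ → tmul (c • x) ξ = c • tmul x ξ)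
    (t_balanced : ∀ x a ξ, MemAS S ξ → tmul (hX.smulA x a) ξ = tmul x fun g => a * ξ g)
    (t_inner : ∀ x x' ξ ξ', MemAS S ξ → MemAS S ξ' →
        hT.inner (tmul x ξ) (tmul x' ξ')
          = ∑' g, (S.α g).symm (star (ξ g) * (hX.inner x x' * ξ' g)))
    (t_smulA : ∀ x ξ a, MemAS S ξ →
        hT.smulA (tmul x ξ) a = tmul x fun g => ξ g * S.α g a)
    (t_dense :
      Dense (↑(Submodule.span ℂ {t : T | ∃ x ξ, MemAS S ξ ∧ t = tmul x ξ}) : Set T)) :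
    ∃ W : T → G → X,
      -- `W` maps into `X^G` and is onto `X^G`
      (∀ t, Summable fun g => hX.inner (W t g) (W t g)) ∧
      (∀ ζ : G → X, (Summable fun g => hX.inner (ζ g) (ζ g)) → ∃ t, W t = ζ) ∧
      -- `W` is a unitary: injective, linear, `A`-linear and inner-product preserving
      Function.Injective W ∧
      (∀ t t', W (t + t') = W t + W t') ∧
      (∀ (c : ℂ) t, W (c • t) = c • W t) ∧
      (∀ t a, W (hT.smulA t a) = fun g => hX.smulA (W t g) a) ∧
      (∀ t t', hT.inner t t' = ∑' g, hX.inner (W t g) (W t' g)) ∧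
      -- the defining formula `[W (x ⊗̇ ξ)](g) = v(g)⁻¹ (x · ξ(g))`
      ∀ x ξ, MemAS S ξ → ∀ g, W (tmul x ξ) g = (er.v g).symm (hX.smulA x (ξ g)) := by
  classical
  let f : G → X →ₗ[ℂ] T := fun g =>
    { toFun := fun x => tmul (er.v g x) (Pi.single g 1)
      map_add' := fun x y => by rw [map_add, t_add_l _ _ _ (memAS_single S g 1)]
      map_smul' := fun c x => by
        rw [map_smul, t_smul _ _ _ (memAS_single S g 1), RingHom.id_apply] }
  have hf_tmul : ∀ g x y ξ, MemAS S ξ →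
      hT.inner (f g x) (tmul y ξ) = hX.inner x ((er.v g).symm (hX.smulA y (ξ g))) := by
    intro g x y ξ hξ
    rw [er.inner_symm_right, hX.inner_smulA_right]
    refine (t_inner _ _ _ _ (memAS_single S g 1) hξ).trans ?_
    rw [tsum_eq_single g fun h hh => by simp [Pi.single_eq_of_ne hh]]
    simp
  have hf : ∀ g x y, hT.inner (f g x) (f g y) = hX.inner x y := by
    intro g x y
    refine (hf_tmul g x _ _ (memAS_single S g 1)).trans ?_
    rw [Pi.single_eq_same, hX.smulA_one, ContinuousLinearEquiv.symm_apply_apply]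
  have hne : ∀ g h, g ≠ h → ∀ x y, hT.inner (f g x) (f h y) = 0 := by
    intro g h hgh x y
    refine (hf_tmul g x _ _ (memAS_single S h 1)).trans ?_
    rw [er.inner_symm_right, hX.inner_smulA_right, Pi.single_eq_of_ne hgh, mul_zero, map_zero]
  have hadj : ∀ g, ∃ P : T →ₗ[ℂ] X, ∀ x t, hT.inner (f g x) t = hX.inner x (P t) := by
    refine fun g => HilbMod.exists_adjoint_of_dense (hf g) t_dense ?_
    rintro _ ⟨x, ξ, hξ, rfl⟩
    exact ⟨_, fun y => hf_tmul g y x ξ hξ⟩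
  choose P hP using hadj
  have hP_tmul : ∀ x ξ, MemAS S ξ → ∀ g,
      P g (tmul x ξ) = (er.v g).symm (hX.smulA x (ξ g)) := fun x ξ hξ g =>
    hX.ext_inner_left fun y => by rw [← hP, hf_tmul g y x ξ hξ]
  have hsum : ∀ t, HasSum (fun g => f g (P g t)) t := by
    refine HilbMod.hasSum_of_dense hf hne hP t_dense ?_
    rintro _ ⟨x, ξ, hξ, rfl⟩
    rw [t_inner x x ξ ξ hξ hξ]
    convert! (hξ.summable_conjugate (hX.inner_self_nonneg x)).hasSum using 2 with g
    rw [hP_tmul x ξ hξ, er.inner_symm_right, ContinuousLinearEquiv.apply_symm_apply,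
      hX.inner_smulA_right, hX.inner_smulA_left, mul_assoc]
  have hinner : ∀ t t', HasSum (fun g => hX.inner (P g t) (P g t')) (hT.inner t t') := by
    intro t t'
    have h := hT.hasSum_inner_right t (hsum t')
    have hcomp : ∀ g, hT.inner t (f g (P g t')) = hX.inner (P g t) (P g t') := fun g => by
      rw [← hT.inner_conj, hP, hX.inner_conj]
    simpa only [← hcomp] using h
  refine ⟨fun t g => P g t, fun t => (hinner t t).summable, fun ζ hζ => ?_, fun s t hst => ?_,
    fun s t => ?_, fun c t => ?_, fun t a => ?_, fun t t' => (hinner t t').tsum_eq.symm, hP_tmul⟩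
  · obtain ⟨t, ht⟩ := HilbMod.exists_components_eq hf hne hP hζ
    exact ⟨t, funext ht⟩
  · refine (hsum s).unique ?_
    simpa only [show ∀ g, P g s = P g t from congrFun hst] using hsum t
  · exact funext fun g => map_add (P g) s t
  · exact funext fun g => map_smul (P g) c t
  · refine funext fun g => hX.ext_inner_left fun x => ?_
    rw [← hP, hT.inner_smulA_right, hX.inner_smulA_right, hP]

end BCFourier
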